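/- The set DS_3 of eigenvalues of 3×3 doubly stochastic matrices equals Π_2 ∪ Π_3, i.e. the union of the segment [−1,1] with the triangle with vertices 1, e^{2πi/3}, e^{−2πi/3}. -/

import Mathlib

open Matrix

/-- DS₃: the set of complex eigenvalues of 3×3 doubly stochastic matrices. -/
def DS3 : Set ℂ :=
  {z | ∃ M : Matrix (Fin 3) (Fin 3) ℝ,
    (∀ i j, 0 ≤ M i j) ∧ (∀ i, ∑ j, M i j = 1) ∧ (∀ j, ∑ i, M i j = 1) ∧
      z ∈ spectrum ℂ (M.map (Complex.ofReal : ℝ → ℂ))}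

/-- The segment `Π₂` is the real interval `[-1, 1]`. -/
lemma mem_convexHull_sq_eq_one {z : ℂ} :
    z ∈ convexHull ℝ {z : ℂ | z ^ 2 = 1} ↔ z.im = 0 ∧ -1 ≤ z.re ∧ z.re ≤ 1 := by
  constructor
  · intro hz
    have hconv : Convex ℝ {z : ℂ | z.im = 0 ∧ -1 ≤ z.re ∧ z.re ≤ 1} := by
      rintro u ⟨hu₀, hu₁, hu₂⟩ v ⟨hv₀, hv₁, hv₂⟩ a b ha hb hab
      simp only [Set.mem_ofPred_eq, Complex.add_re, Complex.add_im, Complex.real_smul,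
        Complex.re_ofReal_mul, Complex.im_ofReal_mul]
      refine ⟨by simp [hu₀, hv₀], ?_, ?_⟩ <;> nlinarith
    refine convexHull_min ?_ hconv hz
    intro w hw
    rcases sq_eq_one_iff.mp hw with rfl | rfl <;> norm_num
  · rintro ⟨h₀, h₁, h₂⟩
    have hz : z = ((1 + z.re) / 2) • (1 : ℂ) + ((1 - z.re) / 2) • (-1 : ℂ) := by
      apply Complex.ext <;> simp [h₀]
      ring
    rw [hz]
    refine convex_convexHull ℝ _ (subset_convexHull ℝ _ (by simp))
      (subset_convexHull ℝ _ (by simp)) ?_ ?_ ?_ <;> linarith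

/-- The triangle `Π₃` as an intersection of three half-planes. -/
lemma mem_convexHull_cube_eq_one {z : ℂ} :
    z ∈ convexHull ℝ {z : ℂ | z ^ 3 = 1} ↔
      -1 / 2 ≤ z.re ∧ √3 * z.im ≤ 1 - z.re ∧ -(√3 * z.im) ≤ 1 - z.re := by
  have h3 : √(3 : ℝ) * √3 = 3 := Real.mul_self_sqrt (by norm_num)
  constructor
  · intro hz
    have hconv : Convex ℝ {z : ℂ | -1 / 2 ≤ z.re ∧ √3 * z.im ≤ 1 - z.re ∧
        -(√3 * z.im) ≤ 1 - z.re} := by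
      rintro u ⟨hu₀, hu₁, hu₂⟩ v ⟨hv₀, hv₁, hv₂⟩ a b ha hb hab
      simp only [Set.mem_ofPred_eq, Complex.add_re, Complex.add_im, Complex.real_smul,
        Complex.re_ofReal_mul, Complex.im_ofReal_mul]
      refine ⟨?_, ?_, ?_⟩ <;> nlinarith
    refine convexHull_min ?_ hconv hz
    intro w hw
    have hw : w ^ 3 = 1 := hw
    have hfac : (w - 1) * (w * w + w + 1) = 0 := by linear_combination hw
    rcases mul_eq_zero.mp hfac with h | h
    · obtain rfl : w = 1 := sub_eq_zero.mp h
      norm_num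
    · have hre := congrArg Complex.re h
      have him := congrArg Complex.im h
      simp only [Complex.add_re, Complex.add_im, Complex.mul_re, Complex.mul_im, Complex.one_re,
        Complex.one_im, Complex.zero_re, Complex.zero_im] at hre him
      have him' : w.im * (2 * w.re + 1) = 0 := by linarith
      rcases mul_eq_zero.mp him' with h' | h'
      · rw [h'] at hre
        nlinarith [sq_nonneg (w.re + 1 / 2)]
      · have hx : w.re = -1 / 2 := by linarith
        rw [hx] at hre
        have hsq : (√3 * w.im) ^ 2 = (3 / 2) ^ 2 := by
          linear_combination w.im ^ 2 * h3 - 3 * hre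
        have := abs_le.mp (abs_le_of_sq_le_sq hsq.le (by norm_num))
        simp only [Set.mem_ofPred_eq, hx]
        refine ⟨le_rfl, ?_, ?_⟩ <;> linarith
  · rintro ⟨h₀, h₁, h₂⟩
    have hcube : ∀ s : ℝ, s * s = 3 → (⟨-1 / 2, s / 2⟩ : ℂ) ^ 3 = 1 := by
      intro s hs
      apply Complex.ext <;> simp only [pow_succ, pow_zero, one_mul, Complex.mul_re, Complex.mul_im,
        Complex.one_re, Complex.one_im]
      · linear_combination 3 / 8 * hs
      · linear_combination -s / 8 * hs
    have hmem := (convex_convexHull ℝ {z : ℂ | z ^ 3 = 1}).sum_mem (t := Finset.univ)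
      (w := ![(1 + 2 * z.re) / 3, (1 - z.re + √3 * z.im) / 3, (1 - z.re - √3 * z.im) / 3])
      (z := ![1, ⟨-1 / 2, √3 / 2⟩, ⟨-1 / 2, -√3 / 2⟩])
      (by
        intro i _
        fin_cases i <;> simp <;> linarith)
      (by
        simp [Fin.sum_univ_three]
        ring)
      (by
        intro i _
        apply subset_convexHull ℝ
        fin_cases i
        · simp
        · exact hcube _ h3
        · exact hcube _ (by linarith))
    convert hmem using 1
    apply Complex.ext <;> simp [Fin.sum_univ_three]
    · ring
    · linear_combination -z.im / 3 * h3

/-- The spectrum of a `3 × 3` real matrix, by its characteristic equation. -/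
lemma mem_spectrum_map_ofReal_iff {M : Matrix (Fin 3) (Fin 3) ℝ} {z : ℂ} :
    z ∈ spectrum ℂ (M.map (Complex.ofReal : ℝ → ℂ)) ↔
      (z - M 0 0) * (z - M 1 1) * (z - M 2 2) - (z - M 0 0) * M 1 2 * M 2 1
        - M 0 1 * M 1 0 * (z - M 2 2) - M 0 1 * M 1 2 * M 2 0
        - M 0 2 * M 1 0 * M 2 1 - M 0 2 * (z - M 1 1) * M 2 0 = 0 := by
  rw [spectrum.mem_iff, Matrix.isUnit_iff_isUnit_det, isUnit_iff_ne_zero, not_not,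
    Matrix.det_fin_three]
  simp only [Matrix.sub_apply, Matrix.algebraMap_matrix_apply, Matrix.map_apply]
  simp
  apply Eq.congr_left
  ring

section Norm

attribute [local instance] Matrix.linftyOpNormedRing Matrix.linftyOpNormedAlgebra

/-- Eigenvalues of a row stochastic matrix lie in the unit disc. -/
lemma norm_le_one_of_mem_spectrum {M : Matrix (Fin 3) (Fin 3) ℝ} (h₀ : ∀ i j, 0 ≤ M i j)
    (hrow : ∀ i, ∑ j, M i j = 1) {z : ℂ}
    (hz : z ∈ spectrum ℂ (M.map (Complex.ofReal : ℝ → ℂ))) : ‖z‖ ≤ 1 := by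
  refine (spectrum.norm_le_norm_of_mem hz).trans ?_
  rw [Matrix.linfty_opNorm_def, ← NNReal.coe_one, NNReal.coe_le_coe]
  refine Finset.sup_le fun i _ => ?_
  rw [← NNReal.coe_le_coe]
  push_cast
  simp [abs_of_nonneg (h₀ _ _), hrow]

end Norm

/-- A nonreal eigenvalue of a doubly stochastic `3 × 3` matrix is a root of the quadratic factor
of the characteristic polynomial. -/
lemma re_eq_and_normSq_eq_of_root {t d : ℝ} {z : ℂ} (him : z.im ≠ 0)
    (h : (z - 1) * (z * z - t * z + d) = 0) : 2 * z.re = t ∧ z.re ^ 2 + z.im ^ 2 = d := by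
  rcases mul_eq_zero.mp h with h | h
  · exact absurd (by simp [sub_eq_zero.mp h]) him
  · have h₁ := congrArg Complex.re h
    have h₂ := congrArg Complex.im h
    simp at h₁ h₂
    have ht : 2 * z.re = t := by
      apply mul_left_cancel₀ him
      linarith
    exact ⟨ht, by rw [← ht] at h₁; linarith⟩

lemma mem_convexHull_of_mem_DS3 {z : ℂ} (hz : z ∈ DS3) :
    z ∈ convexHull ℝ {z : ℂ | z ^ 2 = 1} ∪ convexHull ℝ {z : ℂ | z ^ 3 = 1} := by
  obtain ⟨M, h₀, hrow, hcol, hz⟩ := hz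
  by_cases him : z.im = 0
  · have hn := norm_le_one_of_mem_spectrum h₀ hrow hz
    have := abs_le.mp ((Complex.abs_re_le_norm z).trans hn)
    exact Or.inl (mem_convexHull_sq_eq_one.mpr ⟨him, this⟩)
  · right
    rw [mem_spectrum_map_ofReal_iff] at hz
    have r0 := hrow 0
    have r1 := hrow 1
    have r2 := hrow 2
    have c0 := hcol 0
    have c1 := hcol 1
    simp only [Fin.sum_univ_three] at r0 r1 r2 c0 c1
    have e02 : M 0 2 = 1 - M 0 0 - M 0 1 := by linarith
    have e12 : M 1 2 = 1 - M 1 0 - M 1 1 := by linarith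
    have e20 : M 2 0 = 1 - M 0 0 - M 1 0 := by linarith
    have e21 : M 2 1 = 1 - M 0 1 - M 1 1 := by linarith
    have e22 : M 2 2 = M 0 0 + M 0 1 + M 1 0 + M 1 1 - 1 := by linarith
    have key : M 0 0 + M 1 1 + M 2 2 - 1 = 2 * z.re ∧ z.re ^ 2 + z.im ^ 2 =
        ((M 0 0 + M 1 1 + M 2 2 - 1) ^ 2
          + (M 0 1 + M 1 2 + M 2 0 - M 1 0 - M 2 1 - M 0 2) ^ 2 / 3) / 4
          - ((M 0 0 - M 1 1) ^ 2 + (M 1 1 - M 2 2) ^ 2 + (M 2 2 - M 0 0) ^ 2) / 2 := by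
      refine (re_eq_and_normSq_eq_of_root him ?_).imp_left Eq.symm
      rw [← hz, e02, e12, e20, e21, e22]
      push_cast
      ring
    obtain ⟨htr, hdet⟩ := key
    have hsum : 2 * (1 - z.re) =
        M 0 1 + M 1 2 + M 2 0 + (M 1 0 + M 2 1 + M 0 2) := by linarith
    have hp : 0 ≤ M 0 1 + M 1 2 + M 2 0 := by linarith [h₀ 0 1, h₀ 1 2, h₀ 2 0]
    have hq : 0 ≤ M 1 0 + M 2 1 + M 0 2 := by linarith [h₀ 1 0, h₀ 2 1, h₀ 0 2]
    have hsq : (√3 * z.im) ^ 2 ≤ (1 - z.re) ^ 2 := by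
      rw [mul_pow, Real.sq_sqrt (by norm_num)]
      rw [htr] at hdet
      nlinarith [sq_nonneg (M 0 0 - M 1 1), sq_nonneg (M 1 1 - M 2 2), sq_nonneg (M 2 2 - M 0 0),
        mul_nonneg hp hq]
    have habs := abs_le.mp (abs_le_of_sq_le_sq hsq (by linarith))
    refine mem_convexHull_cube_eq_one.mpr ⟨?_, ?_, ?_⟩
    · linarith [h₀ 0 0, h₀ 1 1, h₀ 2 2]
    · exact habs.2
    · linarith [habs.1]

lemma mem_DS3_of_mem_convexHull_sq {z : ℂ} (hz : z ∈ convexHull ℝ {z : ℂ | z ^ 2 = 1}) :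
    z ∈ DS3 := by
  obtain ⟨him, h₁, h₂⟩ := mem_convexHull_sq_eq_one.mp hz
  refine ⟨!![(1 + z.re) / 2, (1 - z.re) / 2, 0; (1 - z.re) / 2, (1 + z.re) / 2, 0; 0, 0, 1],
    ?_, ?_, ?_, ?_⟩
  · intro i j
    fin_cases i <;> fin_cases j <;> simp <;> linarith
  · intro i
    fin_cases i <;> simp [Fin.sum_univ_three] <;> ring
  · intro j
    fin_cases j <;> simp [Fin.sum_univ_three] <;> ring
  · rw [mem_spectrum_map_ofReal_iff]
    have hz : z = z.re := Complex.ext rfl (by simp [him])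
    generalize z.re = x at hz
    subst hz
    simp
    ring

lemma mem_DS3_of_mem_convexHull_cube {z : ℂ} (hz : z ∈ convexHull ℝ {z : ℂ | z ^ 3 = 1}) :
    z ∈ DS3 := by
  obtain ⟨h₀, h₁, h₂⟩ := mem_convexHull_cube_eq_one.mp hz
  refine ⟨Matrix.of fun i j =>
    ![(1 + 2 * z.re) / 3, (1 - z.re + √3 * z.im) / 3, (1 - z.re - √3 * z.im) / 3] (j - i),
    ?_, ?_, ?_, ?_⟩
  · intro i j
    rw [Matrix.of_apply]
    generalize j - i = k
    fin_cases k <;> simp <;> linarith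
  · intro i
    fin_cases i <;> simp [Fin.sum_univ_three] <;> ring
  · intro j
    fin_cases j <;> simp [Fin.sum_univ_three] <;> ring
  · rw [mem_spectrum_map_ofReal_iff]
    have h3 : ((√3 : ℝ) : ℂ) ^ 2 = 3 := by
      rw [← Complex.ofReal_pow, Real.sq_sqrt (by norm_num)]
      norm_num
    have hz := Complex.re_add_im z
    generalize z.re = x at hz
    generalize z.im = y at hz
    subst hz
    have hI := Complex.I_sq
    simp
    linear_combination (x - 1 + y * Complex.I) * (y ^ 2 * hI + y ^ 2 / 3 * h3)

theorem DS3_eq_Pi2_union_Pi3 :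
    DS3 = convexHull ℝ {z : ℂ | z ^ 2 = 1} ∪ convexHull ℝ {z : ℂ | z ^ 3 = 1} :=
  Set.Subset.antisymm (fun _ => mem_convexHull_of_mem_DS3)
    (Set.union_subset (fun _ => mem_DS3_of_mem_convexHull_sq)
      (fun _ => mem_DS3_of_mem_convexHull_cube))
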